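/- arXiv:1501.04642 — 2 statements merged into one kernel-verified Lean document; each statement's English description precedes it below -/
import Mathlib

section
/- Let G = (V, E) be a finite graph. For each edge e = {i,j} ∈ E let J_e^x, J_e^y, J_e^z ≤ 0 be real couplings, let k_e = Σ_{α∈{x,y,z}} J_e^α (σ^α ⊗ σ^α) (a 4×4 Hermitian matrix), let h_e be the operator on the |V|-qubit Hilbert space (ℂ²)^{⊗V} acting as k_e on the two tensor factors i, j and as the identity on all other factors, and set H = Σ_{e∈E} h_e. Suppose there exists a two-dimensional complex subspace W ⊆ ℂ⁴ contained in the eigenspace of the smallest eigenvalue of k_e for every edge e. Then there exists a unit vector u ∈ ℂ² such that the fully factorized state Ψ = ⊗_{i∈V} u satisfies h_e Ψ = λ_min(k_e) Ψ for every edge e; consequently Ψ is an eigenvector of H with eigenvalue Σ_{e∈E} λ_min(k_e), this eigenvalue is the smallest eigenvalue of H, and for every edge e the frustration f_e = 1 − Tr(Π_e ρ_e) vanishes, where Π_e is the orthogonal projection onto the minimal eigenspace of k_e and ρ_e is the reduced density matrix of the pair {i,j} obtained from |Ψ⟩⟨Ψ| by partial trace over all other qubits. -/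
open Matrix Kronecker BigOperators

noncomputable section

/-- Pauli matrices. -/
def sigmaX : Matrix (Fin 2) (Fin 2) ℂ := !![0, 1; 1, 0]
def sigmaY : Matrix (Fin 2) (Fin 2) ℂ := !![0, -Complex.I; Complex.I, 0]
def sigmaZ : Matrix (Fin 2) (Fin 2) ℂ := !![1, 0; 0, -1]

/-- The operator on the `|V|`-qubit Hilbert space `(ℂ²)^{⊗V}` acting as the 4×4 matrix `k`
on the two tensor factors `i`, `j` and as the identity on all other factors. -/
def twoSiteOp {V : Type*} [Fintype V] [DecidableEq V] (i j : V)
    (k : Matrix (Fin 2 × Fin 2) (Fin 2 × Fin 2) ℂ) :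
    Matrix (V → Fin 2) (V → Fin 2) ℂ :=
  Matrix.of fun s t => if ∀ v, v ≠ i → v ≠ j → s v = t v then k (s i, s j) (t i, t j) else 0

/-- Insert the pair of values `p` at sites `i`, `j` into a configuration `r` of the
remaining sites. -/
def insPair {V : Type*} [DecidableEq V] (i j : V) (p : Fin 2 × Fin 2)
    (r : {v : V // v ≠ i ∧ v ≠ j} → Fin 2) : V → Fin 2 :=
  fun v => if h1 : v = i then p.1 else if h2 : v = j then p.2 else r ⟨v, ⟨h1, h2⟩⟩

/-- The reduced density matrix of the pair `{i,j}`, obtained from a density matrix on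
`(ℂ²)^{⊗V}` by partial trace over all the other qubits (entrywise sum over matching
indices of the traced-out factors). -/
def reducedPair {V : Type*} [Fintype V] [DecidableEq V] (i j : V)
    (ρ : Matrix (V → Fin 2) (V → Fin 2) ℂ) :
    Matrix (Fin 2 × Fin 2) (Fin 2 × Fin 2) ℂ :=
  Matrix.of fun p q =>
    ∑ r : {v : V // v ≠ i ∧ v ≠ j} → Fin 2, ρ (insPair i j p r) (insPair i j q r)

open scoped ComplexOrder

section InsPair

variable {V : Type*} [DecidableEq V] {i j : V}

lemma insPair_fst (p : Fin 2 × Fin 2) (r : {v : V // v ≠ i ∧ v ≠ j} → Fin 2) :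
    insPair i j p r i = p.1 := by
  simp [insPair]

lemma insPair_snd (hij : i ≠ j) (p : Fin 2 × Fin 2) (r : {v : V // v ≠ i ∧ v ≠ j} → Fin 2) :
    insPair i j p r j = p.2 := by
  simp [insPair, hij.symm]

lemma insPair_coe (p : Fin 2 × Fin 2) (r : {v : V // v ≠ i ∧ v ≠ j} → Fin 2)
    (v : {v : V // v ≠ i ∧ v ≠ j}) : insPair i j p r v = r v := by
  simp [insPair, v.2.1, v.2.2]

/-- Configurations split into the values at `i`, `j` and the values at the other sites. -/
def insPairEquiv (hij : i ≠ j) :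
    ({v : V // v ≠ i ∧ v ≠ j} → Fin 2) × (Fin 2 × Fin 2) ≃ (V → Fin 2) where
  toFun x := insPair i j x.2 x.1
  invFun s := (fun v => s v, (s i, s j))
  left_inv x := by
    refine Prod.ext (funext fun v => insPair_coe _ _ v) (Prod.ext ?_ ?_)
    · exact insPair_fst _ _
    · exact insPair_snd hij _ _
  right_inv s := by
    funext v
    simp only [insPair]
    split_ifs with h1 h2
    · rw [h1]
    · rw [h2]
    · rfl

variable [Fintype V]

lemma sum_insPair {M : Type*} [AddCommMonoid M] (hij : i ≠ j) (f : (V → Fin 2) → M) :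
    ∑ r, ∑ p, f (insPair i j p r) = ∑ s, f s := by
  rw [← Fintype.sum_prod_type' (f := fun r p => f (insPair i j p r))]
  exact (insPairEquiv hij).sum_comp f

lemma prod_insPair {M : Type*} [CommMonoid M] (hij : i ≠ j) (u : Fin 2 → M) (p : Fin 2 × Fin 2)
    (r : {v : V // v ≠ i ∧ v ≠ j} → Fin 2) :
    ∏ v, u (insPair i j p r v) = u p.1 * u p.2 * ∏ v, u (r v) := by
  have hj : j ∈ Finset.univ.erase i := by simp [hij.symm]
  have hs (v : V) : v ∈ (Finset.univ.erase i).erase j ↔ v ≠ i ∧ v ≠ j := by simp [and_comm]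
  rw [← Finset.mul_prod_erase _ _ (Finset.mem_univ i), ← Finset.mul_prod_erase _ _ hj,
    Finset.prod_subtype (F := inferInstance) _ hs, insPair_fst, insPair_snd hij, mul_assoc]
  simp only [insPair_coe]

lemma twoSiteOp_insPair (hij : i ≠ j) (k : Matrix (Fin 2 × Fin 2) (Fin 2 × Fin 2) ℂ)
    (p q : Fin 2 × Fin 2) (r r' : {v : V // v ≠ i ∧ v ≠ j} → Fin 2) :
    twoSiteOp i j k (insPair i j p r) (insPair i j q r') = if r = r' then k p q else 0 := by
  have : (∀ v, v ≠ i → v ≠ j → insPair i j p r v = insPair i j q r' v) ↔ r = r' := by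
    constructor
    · intro h
      funext v
      simpa only [insPair_coe] using h v v.2.1 v.2.2
    · rintro rfl v h1 h2
      simp [insPair, h1, h2]
  simp only [twoSiteOp, Matrix.of_apply, this, insPair_fst, insPair_snd hij]

lemma twoSiteOp_mulVec_insPair (hij : i ≠ j) (k : Matrix (Fin 2 × Fin 2) (Fin 2 × Fin 2) ℂ)
    (v : (V → Fin 2) → ℂ) (p : Fin 2 × Fin 2) (r : {v : V // v ≠ i ∧ v ≠ j} → Fin 2) :
    (twoSiteOp i j k).mulVec v (insPair i j p r)
      = k.mulVec (fun q => v (insPair i j q r)) p := by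
  simp only [Matrix.mulVec, dotProduct]
  rw [← sum_insPair hij]
  rw [Finset.sum_comm]
  simp [twoSiteOp_insPair hij, ite_mul]

lemma star_dotProduct_twoSiteOp_mulVec (hij : i ≠ j)
    (k : Matrix (Fin 2 × Fin 2) (Fin 2 × Fin 2) ℂ) (v : (V → Fin 2) → ℂ) :
    star v ⬝ᵥ (twoSiteOp i j k).mulVec v
      = ∑ r, star (fun q => v (insPair i j q r)) ⬝ᵥ k.mulVec (fun q => v (insPair i j q r)) := by
  rw [dotProduct, ← sum_insPair hij]
  simp only [twoSiteOp_mulVec_insPair hij]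
  rfl

lemma mulVec_prod_insPair (hij : i ≠ j) {k : Matrix (Fin 2 × Fin 2) (Fin 2 × Fin 2) ℂ}
    {u : Fin 2 → ℂ} {c : ℂ}
    (hu : k.mulVec (fun p => u p.1 * u p.2) = c • fun p => u p.1 * u p.2)
    (r : {v : V // v ≠ i ∧ v ≠ j} → Fin 2) :
    k.mulVec (fun q => ∏ v, u (insPair i j q r v)) = c • fun q => ∏ v, u (insPair i j q r v) := by
  have h : (fun q => ∏ v, u (insPair i j q r v))
      = (∏ v, u (r v)) • fun q : Fin 2 × Fin 2 => u q.1 * u q.2 := by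
    funext q
    rw [prod_insPair hij, mul_comm]
    rfl
  rw [h, Matrix.mulVec_smul, hu, smul_comm]

lemma twoSiteOp_mulVec_prod (hij : i ≠ j) {k : Matrix (Fin 2 × Fin 2) (Fin 2 × Fin 2) ℂ}
    {u : Fin 2 → ℂ} {c : ℂ}
    (hu : k.mulVec (fun p => u p.1 * u p.2) = c • fun p => u p.1 * u p.2) :
    (twoSiteOp i j k).mulVec (fun s => ∏ v, u (s v)) = c • fun s => ∏ v, u (s v) := by
  funext s
  obtain ⟨⟨r, p⟩, rfl⟩ := (insPairEquiv hij).surjective s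
  exact (twoSiteOp_mulVec_insPair hij k _ p r).trans (congrFun (mulVec_prod_insPair hij hu r) p)

lemma trace_mul_reducedPair (A : Matrix (Fin 2 × Fin 2) (Fin 2 × Fin 2) ℂ)
    (Ψ : (V → Fin 2) → ℂ) :
    (A * reducedPair i j (Matrix.of fun s t => Ψ s * (starRingEnd ℂ) (Ψ t))).trace
      = ∑ r, ∑ p, A.mulVec (fun q => Ψ (insPair i j q r)) p
          * (starRingEnd ℂ) (Ψ (insPair i j p r)) := by
  simp only [Matrix.trace, Matrix.diag, Matrix.mul_apply, reducedPair, Matrix.of_apply,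
    Matrix.mulVec, dotProduct, Finset.mul_sum, Finset.sum_mul]
  simp only [mul_assoc]
  rw [Finset.sum_comm (s := (Finset.univ : Finset ({v : V // v ≠ i ∧ v ≠ j} → Fin 2)))]
  exact Finset.sum_congr rfl fun p _ => Finset.sum_comm

end InsPair

lemma sum_prod_mul_conj {V : Type*} [Fintype V] [DecidableEq V] {u : Fin 2 → ℂ}
    (hu : ∑ a, Complex.normSq (u a) = 1) :
    ∑ s : V → Fin 2, (∏ v, u (s v)) * (starRingEnd ℂ) (∏ v, u (s v)) = 1 := by
  have h : ∑ a, u a * (starRingEnd ℂ) (u a) = 1 := by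
    simp only [Complex.mul_conj]
    exact_mod_cast hu
  simp only [map_prod, ← Finset.prod_mul_distrib]
  rw [← Fintype.prod_sum (fun (_ : V) a => u a * (starRingEnd ℂ) (u a))]
  simp [h]

/-- A Hermitian matrix is bounded below by its smallest eigenvalue. -/
lemma Matrix.IsHermitian.posSemidef_sub_smul_one {n : Type*} [Fintype n] [DecidableEq n]
    {A : Matrix n n ℂ} (hA : A.IsHermitian) {m : ℝ}
    (hm : m ∈ lowerBounds {c : ℝ | ∃ v : n → ℂ, v ≠ 0 ∧ A.mulVec v = (c : ℂ) • v}) :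
    (A - (m : ℂ) • (1 : Matrix n n ℂ)).PosSemidef := by
  have hB : (A - (m : ℂ) • (1 : Matrix n n ℂ)).IsHermitian := by
    refine hA.sub ?_
    simp [Matrix.IsHermitian, Matrix.conjTranspose_smul]
  rw [hB.posSemidef_iff_eigenvalues_nonneg]
  intro a
  have h := hB.mulVec_eigenvectorBasis a
  have hmem : hB.eigenvalues a + m ∈
      {c : ℝ | ∃ v : n → ℂ, v ≠ 0 ∧ A.mulVec v = (c : ℂ) • v} := by
    refine ⟨_, (WithLp.ofLp_eq_zero 2).not.mpr (hB.eigenvectorBasis.orthonormal.ne_zero a), ?_⟩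
    rw [Matrix.sub_mulVec, Matrix.smul_mulVec, Matrix.one_mulVec, sub_eq_iff_eq_add] at h
    rw [h, Complex.ofReal_add, add_smul]
    rfl
  have := hm hmem
  simpa using this

lemma exists_binary_quadratic_zero {K : Type*} [Field K] [IsAlgClosed K] [NeZero (2 : K)]
    (a b c : K) :
    ∃ x y : K, (x ≠ 0 ∨ y ≠ 0) ∧ a * (x * x) + b * (x * y) + c * (y * y) = 0 := by
  by_cases ha : a = 0
  · exact ⟨1, 0, by simp, by simp [ha]⟩
  · obtain ⟨z, hz⟩ := IsAlgClosed.exists_eq_mul_self (discrim a b c)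
    obtain ⟨x, hx⟩ := exists_quadratic_eq_zero ha ⟨z, hz⟩
    exact ⟨x, 1, by simp, by simpa using hx⟩

/-- A symmetric two-qubit vector of vanishing determinant is a square `u ⊗ u`. -/
lemma exists_eq_tensor_square {w : Fin 2 × Fin 2 → ℂ} (hsymm : w (0, 1) = w (1, 0))
    (hdet : w (0, 0) * w (1, 1) = w (0, 1) * w (0, 1)) :
    ∃ u : Fin 2 → ℂ, w = fun p => u p.1 * u p.2 := by
  obtain ⟨z, hz⟩ := IsAlgClosed.exists_eq_mul_self (w (0, 0))
  by_cases h0 : w (0, 0) = 0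
  · obtain ⟨y, hy⟩ := IsAlgClosed.exists_eq_mul_self (w (1, 1))
    have h1 : w (0, 1) = 0 := by simpa [h0] using hdet.symm
    refine ⟨![0, y], funext fun ⟨a, b⟩ => ?_⟩
    fin_cases a <;> fin_cases b <;> simp [h0, h1, hy, ← hsymm]
  · have hz0 : z ≠ 0 := by rintro rfl; simp [hz] at h0
    refine ⟨![z, w (0, 1) / z], funext fun ⟨a, b⟩ => ?_⟩
    fin_cases a <;> fin_cases b <;> simp [hz, ← hsymm] <;> field_simp
    rw [hz] at hdet
    linear_combination hdet

/-- A two-dimensional space of symmetric two-qubit vectors contains some `u ⊗ u ≠ 0`. -/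
lemma exists_tensor_square_mem {W : Submodule ℂ (Fin 2 × Fin 2 → ℂ)}
    (hW : Module.finrank ℂ W = 2) (hsymm : ∀ w ∈ W, w (0, 1) = w (1, 0)) :
    ∃ u : Fin 2 → ℂ, u ≠ 0 ∧ (fun p => u p.1 * u p.2) ∈ W := by
  let B := Module.finBasisOfFinrankEq ℂ W hW
  let f : Fin 2 × Fin 2 → ℂ := B 0
  let g : Fin 2 × Fin 2 → ℂ := B 1
  obtain ⟨x, y, hxy, hq⟩ := exists_binary_quadratic_zero
    (f (0, 0) * f (1, 1) - f (0, 1) * f (0, 1))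
    (f (0, 0) * g (1, 1) + g (0, 0) * f (1, 1) - 2 * (f (0, 1) * g (0, 1)))
    (g (0, 0) * g (1, 1) - g (0, 1) * g (0, 1))
  have hw : x • f + y • g ∈ W :=
    W.add_mem (W.smul_mem x (B 0).2) (W.smul_mem y (B 1).2)
  have hne : x • f + y • g ≠ 0 := by
    intro h
    have h' : x • B 0 + y • B 1 = 0 := Subtype.ext h
    have hli := Fintype.linearIndependent_iff.mp B.linearIndependent ![x, y] (by simpa using h')
    exact hxy.elim (fun hx => hx (hli 0)) (fun hy => hy (hli 1))
  obtain ⟨u, hu⟩ := exists_eq_tensor_square (hsymm _ hw) (by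
    simp only [Pi.add_apply, Pi.smul_apply, smul_eq_mul]
    linear_combination hq)
  refine ⟨u, ?_, hu ▸ hw⟩
  rintro rfl
  exact hne (by rw [hu]; funext p; simp)

lemma exists_unit_tensor_square_mem {W : Submodule ℂ (Fin 2 × Fin 2 → ℂ)}
    (hW : Module.finrank ℂ W = 2) (hsymm : ∀ w ∈ W, w (0, 1) = w (1, 0)) :
    ∃ u : Fin 2 → ℂ, ∑ a, Complex.normSq (u a) = 1 ∧ (fun p => u p.1 * u p.2) ∈ W := by
  obtain ⟨u, hu, hmem⟩ := exists_tensor_square_mem hW hsymm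
  have hpos : 0 < ∑ a, Complex.normSq (u a) := by
    obtain ⟨a, ha⟩ := Function.ne_iff.mp hu
    exact Finset.sum_pos' (fun _ _ => Complex.normSq_nonneg _)
      ⟨a, Finset.mem_univ a, Complex.normSq_pos.mpr ha⟩
  set N := ∑ a, Complex.normSq (u a) with hN
  refine ⟨(((√N)⁻¹ : ℝ) : ℂ) • u, ?_, ?_⟩
  · simp only [Pi.smul_apply, smul_eq_mul, Complex.normSq_mul, Complex.normSq_ofReal,
      ← Finset.mul_sum, ← hN]
    rw [← mul_inv, Real.mul_self_sqrt hpos.le, inv_mul_cancel₀ hpos.ne']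
  · convert W.smul_mem ((((√N)⁻¹ : ℝ) : ℂ) * (((√N)⁻¹ : ℝ) : ℂ)) hmem using 1
    funext p
    simp only [Pi.smul_apply, smul_eq_mul]
    ring

section PauliPair

/-- The pair Hamiltonian `Σ_α Jᵅ σᵅ ⊗ σᵅ`. -/
def pauliPair (a b c : ℝ) : Matrix (Fin 2 × Fin 2) (Fin 2 × Fin 2) ℂ :=
  (a : ℂ) • (sigmaX ⊗ₖ sigmaX) + (b : ℂ) • (sigmaY ⊗ₖ sigmaY) + (c : ℂ) • (sigmaZ ⊗ₖ sigmaZ)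

variable (a b c : ℝ)

lemma pauliPair_isHermitian : (pauliPair a b c).IsHermitian := by
  ext ⟨p, q⟩ ⟨r, s⟩
  fin_cases p <;> fin_cases q <;> fin_cases r <;> fin_cases s <;>
    simp [pauliPair, sigmaX, sigmaY, sigmaZ, Matrix.conjTranspose_apply]

lemma pauliPair_mulVec (v : Fin 2 × Fin 2 → ℂ) :
    (pauliPair a b c).mulVec v = fun p =>
      (!![c * v (0, 0) + (a - b) * v (1, 1), (a + b) * v (1, 0) - c * v (0, 1);
        (a + b) * v (0, 1) - c * v (1, 0), (a - b) * v (0, 0) + c * v (1, 1)] :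
          Matrix (Fin 2) (Fin 2) ℂ) p.1 p.2 := by
  funext ⟨p, q⟩
  fin_cases p <;> fin_cases q <;>
    simp [pauliPair, sigmaX, sigmaY, sigmaZ, Matrix.mulVec, dotProduct,
      Fintype.sum_prod_type, -mul_eq_mul_right_iff] <;> ring

variable {a b c}

/-- If some coupling is nonzero, the minimal eigenspace consists of symmetric vectors. -/
lemma pauliPair_eq_zero_or_symm (ha : a ≤ 0) (hb : b ≤ 0) (hc : c ≤ 0) {m : ℝ}
    (hm : m ∈ lowerBounds {x : ℝ | ∃ v : Fin 2 × Fin 2 → ℂ, v ≠ 0 ∧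
      (pauliPair a b c).mulVec v = (x : ℂ) • v}) :
    (pauliPair a b c = 0) ∨
      ∀ w, (pauliPair a b c).mulVec w = (m : ℂ) • w → w (0, 1) = w (1, 0) := by
  by_cases hs : m = -(a + b + c)
  · have h1 : m ≤ a - b + c := hm ⟨fun p => if p.1 = p.2 then 1 else 0,
      Function.ne_iff.mpr ⟨(0, 0), by simp⟩, by
        rw [pauliPair_mulVec]
        funext ⟨p, q⟩
        fin_cases p <;> fin_cases q <;> simp
        ring⟩
    have h2 : m ≤ -a + b + c := hm ⟨fun p =>
        if p = (0, 0) then 1 else if p = (1, 1) then -1 else 0,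
      Function.ne_iff.mpr ⟨(0, 0), by simp⟩, by
        rw [pauliPair_mulVec]
        funext ⟨p, q⟩
        fin_cases p <;> fin_cases q <;> simp <;> ring⟩
    have h3 : m ≤ a + b - c := hm ⟨fun p => if p.1 = p.2 then 0 else 1,
      Function.ne_iff.mpr ⟨(0, 1), by simp⟩, by
        rw [pauliPair_mulVec]
        funext ⟨p, q⟩
        fin_cases p <;> fin_cases q <;> simp⟩
    left
    have ha0 : a = 0 := by linarith
    have hb0 : b = 0 := by linarith
    have hc0 : c = 0 := by linarith
    simp [pauliPair, ha0, hb0, hc0]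
  · right
    intro w hw
    rw [pauliPair_mulVec] at hw
    have h01 := congrFun hw (0, 1)
    have h10 := congrFun hw (1, 0)
    simp at h01 h10
    have hs' : (m : ℂ) + (a + b + c) ≠ 0 := by
      intro h
      apply hs
      have : m + (a + b + c) = 0 := by exact_mod_cast h
      linarith
    have : ((m : ℂ) + (a + b + c)) * (w (0, 1) - w (1, 0)) = 0 := by
      linear_combination h10 - h01
    exact sub_eq_zero.mp ((mul_eq_zero.mp this).resolve_left hs')

end PauliPair


/-- For a finite graph with ferromagnetic couplings `Jᵅ_e ≤ 0`, local pair
Hamiltonians `k_e = Σ_α Jᵅ_e σᵅ⊗σᵅ` with smallest eigenvalue `μ_e`, embedded operators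
`h_e` and total Hamiltonian `H = Σ_e h_e`: if a two-dimensional subspace `W ⊆ ℂ⁴` is
contained in the minimal eigenspace of every `k_e`, then there is a unit vector `u ∈ ℂ²`
whose fully factorized state `Ψ = ⊗_V u` is a simultaneous ground state of all the `h_e`,
is an eigenvector of `H` with eigenvalue `Σ_e μ_e`, this is the smallest eigenvalue of `H`,
and all the pair frustrations `f_e = 1 − Tr(Π_e ρ_e)` vanish. -/
theorem globalToLocal_prototype_frustration_free
    {V E : Type*} [Fintype V] [DecidableEq V] [Fintype E]
    (fst snd : E → V) (hedge : ∀ e, fst e ≠ snd e)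
    (Jx Jy Jz : E → ℝ) (hJx : ∀ e, Jx e ≤ 0) (hJy : ∀ e, Jy e ≤ 0) (hJz : ∀ e, Jz e ≤ 0)
    (k : E → Matrix (Fin 2 × Fin 2) (Fin 2 × Fin 2) ℂ)
    (hk : ∀ e, k e = (Jx e : ℂ) • (sigmaX ⊗ₖ sigmaX) + (Jy e : ℂ) • (sigmaY ⊗ₖ sigmaY)
      + (Jz e : ℂ) • (sigmaZ ⊗ₖ sigmaZ))
    -- μ e is the smallest eigenvalue of k e
    (μ : E → ℝ)
    (hμ : ∀ e, IsLeast {c : ℝ | ∃ v : Fin 2 × Fin 2 → ℂ, v ≠ 0 ∧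
      (k e).mulVec v = (c : ℂ) • v} (μ e))
    -- W is a two-dimensional subspace contained in the minimal eigenspace of every k e
    (W : Submodule ℂ (Fin 2 × Fin 2 → ℂ)) (hWdim : Module.finrank ℂ W = 2)
    (hW : ∀ e, ∀ w ∈ W, (k e).mulVec w = (μ e : ℂ) • w)
    -- the embedded local Hamiltonians and the total Hamiltonian
    (h : E → Matrix (V → Fin 2) (V → Fin 2) ℂ)
    (hh : ∀ e, h e = twoSiteOp (fst e) (snd e) (k e))
    (H : Matrix (V → Fin 2) (V → Fin 2) ℂ) (hH : H = ∑ e, h e)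
    -- Π e is the orthogonal projection onto the minimal eigenspace of k e
    (Pi : E → Matrix (Fin 2 × Fin 2) (Fin 2 × Fin 2) ℂ)
    (hPiherm : ∀ e, (Pi e).IsHermitian)
    (hPiidem : ∀ e, Pi e * Pi e = Pi e)
    (hPirange : ∀ e, ∀ v : Fin 2 × Fin 2 → ℂ,
      (Pi e).mulVec v = v ↔ (k e).mulVec v = (μ e : ℂ) • v) :
    ∃ (u : Fin 2 → ℂ) (Ψ : (V → Fin 2) → ℂ),
      (∑ i, Complex.normSq (u i)) = 1 ∧
      Ψ = (fun s => ∏ v, u (s v)) ∧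
      (∀ e, (h e).mulVec Ψ = (μ e : ℂ) • Ψ) ∧
      H.mulVec Ψ = ((∑ e, μ e : ℝ) : ℂ) • Ψ ∧
      IsLeast {c : ℝ | ∃ v : (V → Fin 2) → ℂ, v ≠ 0 ∧ H.mulVec v = (c : ℂ) • v}
        (∑ e, μ e) ∧
      (∀ e, 1 - (Pi e * reducedPair (fst e) (snd e)
        (Matrix.of fun s t => Ψ s * (starRingEnd ℂ) (Ψ t))).trace = 0) := by
  obtain rfl : k = fun e => pauliPair (Jx e) (Jy e) (Jz e) := funext hk
  obtain rfl : h = fun e => twoSiteOp (fst e) (snd e) (pauliPair (Jx e) (Jy e) (Jz e)) :=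
    funext hh
  subst hH
  beta_reduce at *
  obtain ⟨u, hu, hku⟩ : ∃ u : Fin 2 → ℂ, ∑ a, Complex.normSq (u a) = 1 ∧
      ∀ e, (pauliPair (Jx e) (Jy e) (Jz e)).mulVec (fun p => u p.1 * u p.2)
        = (μ e : ℂ) • fun p => u p.1 * u p.2 := by
    by_cases hsymm : ∀ w ∈ W, w (0, 1) = w (1, 0)
    · obtain ⟨u, hu, hmem⟩ := exists_unit_tensor_square_mem hWdim hsymm
      exact ⟨u, hu, fun e => hW e _ hmem⟩
    · push Not at hsymm
      obtain ⟨w, hw, hne⟩ := hsymm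
      refine ⟨![1, 0], by simp, fun e => ?_⟩
      have h0 := (pauliPair_eq_zero_or_symm (hJx e) (hJy e) (hJz e) (hμ e).2).resolve_right
        fun h => hne (h w (hW e w hw))
      obtain ⟨v, hv, hkv⟩ := (hμ e).1
      rw [h0, Matrix.zero_mulVec, eq_comm, smul_eq_zero, or_iff_left hv] at hkv
      rw [h0, hkv, Matrix.zero_mulVec, zero_smul]
  have hloc e := twoSiteOp_mulVec_prod (hedge e) (hku e)
  have hglob : (∑ e, twoSiteOp (fst e) (snd e) (pauliPair (Jx e) (Jy e) (Jz e))).mulVec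
      (fun s : V → Fin 2 => ∏ v, u (s v)) = ((∑ e, μ e : ℝ) : ℂ) • fun s => ∏ v, u (s v) := by
    rw [Matrix.sum_mulVec, Complex.ofReal_sum, Finset.sum_smul]
    exact Finset.sum_congr rfl fun e _ => hloc e
  have hnorm := sum_prod_mul_conj (V := V) hu
  refine ⟨u, _, hu, rfl, hloc, hglob, ⟨⟨_, ?_, hglob⟩, ?_⟩, fun e => ?_⟩
  · intro h0
    simp [fun s => congrFun h0 s] at hnorm
  · rintro c ⟨v, hv, hHv⟩
    have hpos : 0 < star v ⬝ᵥ v := Matrix.dotProduct_star_self_pos_iff.mpr hv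
    have hle e : (μ e : ℂ) * (star v ⬝ᵥ v) ≤ star v ⬝ᵥ
        (twoSiteOp (fst e) (snd e) (pauliPair (Jx e) (Jy e) (Jz e))).mulVec v := by
      rw [star_dotProduct_twoSiteOp_mulVec (hedge e), dotProduct, ← sum_insPair (hedge e),
        Finset.mul_sum]
      refine Finset.sum_le_sum fun r _ => ?_
      have := ((pauliPair_isHermitian _ _ _).posSemidef_sub_smul_one
        (hμ e).2).dotProduct_mulVec_nonneg fun q => v (insPair (fst e) (snd e) q r)
      rw [Matrix.sub_mulVec, Matrix.smul_mulVec, Matrix.one_mulVec, dotProduct_sub,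
        dotProduct_smul, sub_nonneg] at this
      exact this
    have hsum := Finset.sum_le_sum fun e (_ : e ∈ Finset.univ) => hle e
    rw [← Finset.sum_mul, ← dotProduct_sum, ← Matrix.sum_mulVec, hHv, dotProduct_smul,
      smul_eq_mul] at hsum
    have := le_of_mul_le_mul_right hsum hpos
    exact_mod_cast this
  · rw [trace_mul_reducedPair, sub_eq_zero, ← hnorm, ← sum_insPair (hedge e)]
    refine Finset.sum_congr rfl fun r _ => Finset.sum_congr rfl fun p _ => ?_
    rw [(hPirange e _).mpr (mulVec_prod_insPair (hedge e) (hku e) r)]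


end
end

section
/- Let ρ = (1/4)I₄ + g_x σ^x⊗σ^x + g_y σ^y⊗σ^y + g_z σ^z⊗σ^z be positive semidefinite (hence a two-qubit density matrix), let ρ̃ = (σ^y⊗σ^y) conj(ρ) (σ^y⊗σ^y), let ν₁ ≥ ν₂ ≥ ν₃ ≥ ν₄ ≥ 0 be the eigenvalues of ρρ̃, and define the Wootters concurrence C(ρ) = max(0, √ν₁ − √ν₂ − √ν₃ − √ν₄). Then C(ρ) = max(0, 2λ_max(ρ) − 1) = max(0, 1 − 2ε), where λ_max(ρ) is the largest eigenvalue of ρ and ε = 1 − λ_max(ρ). -/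
open Matrix Kronecker BigOperators

noncomputable section

/-- The Bell-diagonal matrix `ρ(g) = ¼I₄ + g_x σˣ⊗σˣ + g_y σʸ⊗σʸ + g_z σᶻ⊗σᶻ`. -/
def rhoBD (gx gy gz : ℝ) : Matrix (Fin 2 × Fin 2) (Fin 2 × Fin 2) ℂ :=
  (1/4 : ℂ) • (1 : Matrix (Fin 2 × Fin 2) (Fin 2 × Fin 2) ℂ)
    + (gx : ℂ) • (sigmaX ⊗ₖ sigmaX) + (gy : ℂ) • (sigmaY ⊗ₖ sigmaY)
    + (gz : ℂ) • (sigmaZ ⊗ₖ sigmaZ)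

/-- The unnormalized Bell basis, as the columns of a matrix. -/
def bellBasis : Matrix (Fin 2 × Fin 2) (Fin 2 × Fin 2) ℂ :=
  fun i j => if i.1 + i.2 = j.1 then (if i.1 = 1 ∧ j.2 = 1 then -1 else 1) else 0

/-- The eigenvalues of `rhoBD gx gy gz` on the columns of `bellBasis`. -/
def bellEigenvalue (gx gy gz : ℝ) (p : Fin 2 × Fin 2) : ℝ :=
  1 / 4 + (-1) ^ (p.2 : ℕ) * gx - (-1) ^ (p.1 + p.2 : ℕ) * gy + (-1) ^ (p.1 : ℕ) * gz

theorem sum_bellEigenvalue (gx gy gz : ℝ) : ∑ p, bellEigenvalue gx gy gz p = 1 := by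
  simp only [Fintype.sum_prod_type, Fin.sum_univ_two, bellEigenvalue]
  norm_num
  ring

theorem bellBasis_conjTranspose_mul_self : bellBasisᴴ * bellBasis = (2 : ℂ) • 1 := by
  ext ⟨a, b⟩ ⟨c, d⟩
  fin_cases a <;> fin_cases b <;> fin_cases c <;> fin_cases d <;>
    simp [bellBasis, Matrix.mul_apply, Fintype.sum_prod_type] <;> norm_num

theorem isUnit_bellBasis : IsUnit bellBasis := by
  refine (Matrix.isUnit_iff_isUnit_det _).2
    (Matrix.isUnit_det_of_left_inverse (B := (2⁻¹ : ℂ) • bellBasisᴴ) ?_)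
  rw [Matrix.smul_mul, bellBasis_conjTranspose_mul_self, smul_smul]
  norm_num

theorem rhoBD_mul_bellBasis (gx gy gz : ℝ) :
    rhoBD gx gy gz * bellBasis =
      bellBasis * diagonal (fun p => (bellEigenvalue gx gy gz p : ℂ)) := by
  ext ⟨a, b⟩ ⟨c, d⟩
  rw [Matrix.mul_diagonal]
  fin_cases a <;> fin_cases b <;> fin_cases c <;> fin_cases d <;>
    simp [rhoBD, sigmaX, sigmaY, sigmaZ, bellBasis, bellEigenvalue, Matrix.mul_apply,
      Fintype.sum_prod_type, Matrix.one_apply] <;> ring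

theorem rhoBD_eq_conj_diagonal (gx gy gz : ℝ) :
    rhoBD gx gy gz =
      bellBasis * diagonal (fun p => (bellEigenvalue gx gy gz p : ℂ)) * bellBasis⁻¹ := by
  rw [← rhoBD_mul_bellBasis, Matrix.mul_nonsing_inv_cancel_right _ _
    ((Matrix.isUnit_iff_isUnit_det _).1 isUnit_bellBasis)]

/-- Bell-diagonal matrices are invariant under the spin flip. -/
theorem spinFlip_rhoBD (gx gy gz : ℝ) :
    (sigmaY ⊗ₖ sigmaY) * (rhoBD gx gy gz).map (starRingEnd ℂ) * (sigmaY ⊗ₖ sigmaY) =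
      rhoBD gx gy gz := by
  ext ⟨a, b⟩ ⟨c, d⟩
  fin_cases a <;> fin_cases b <;> fin_cases c <;> fin_cases d <;>
    simp [rhoBD, sigmaX, sigmaY, sigmaZ, Matrix.mul_apply, Fintype.sum_prod_type,
      Matrix.one_apply, Complex.conj_ofNat]

theorem rhoBD_mul_self (gx gy gz : ℝ) :
    rhoBD gx gy gz * rhoBD gx gy gz =
      bellBasis * diagonal (fun p => ((bellEigenvalue gx gy gz p ^ 2 : ℝ) : ℂ)) *
        bellBasis⁻¹ := by
  have h : rhoBD gx gy gz * rhoBD gx gy gz * bellBasis =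
      bellBasis * diagonal (fun p => ((bellEigenvalue gx gy gz p ^ 2 : ℝ) : ℂ)) := by
    rw [Matrix.mul_assoc, rhoBD_mul_bellBasis, ← Matrix.mul_assoc, rhoBD_mul_bellBasis,
      Matrix.mul_assoc, Matrix.diagonal_mul_diagonal]
    simp [pow_two]
  rw [← h, Matrix.mul_nonsing_inv_cancel_right _ _
    ((Matrix.isUnit_iff_isUnit_det _).1 isUnit_bellBasis)]

open ComplexOrder in
theorem bellEigenvalue_nonneg {gx gy gz : ℝ} (h : (rhoBD gx gy gz).PosSemidef)
    (p : Fin 2 × Fin 2) : 0 ≤ bellEigenvalue gx gy gz p := by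
  have h2 := (h.conjTranspose_mul_mul_same bellBasis).diag_nonneg (i := p)
  rw [Matrix.mul_assoc, rhoBD_mul_bellBasis, ← Matrix.mul_assoc,
    bellBasis_conjTranspose_mul_self] at h2
  simpa [← Complex.ofReal_ofNat, ← Complex.ofReal_mul] using h2

theorem Matrix.exists_mulVec_eq_smul_conj_diagonal_iff {n K : Type*} [Fintype n]
    [DecidableEq n] [Field K] {P : Matrix n n K} (hP : IsUnit P) (d : n → K) (c : K) :
    (∃ v : n → K, v ≠ 0 ∧ (P * diagonal d * P⁻¹) *ᵥ v = c • v) ↔ ∃ i, d i = c := by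
  have hdet := (Matrix.isUnit_iff_isUnit_det P).1 hP
  constructor
  · rintro ⟨v, hv, h⟩
    have hw : diagonal d *ᵥ (P⁻¹ *ᵥ v) = c • (P⁻¹ *ᵥ v) := by
      rw [← Matrix.mulVec_smul, ← h]
      simp [Matrix.mulVec_mulVec, ← Matrix.mul_assoc, Matrix.nonsing_inv_mul _ hdet]
    by_contra! hne
    refine hv ?_
    have hz : P⁻¹ *ᵥ v = 0 := by
      funext i
      have hi := congrFun hw i
      rw [Matrix.mulVec_diagonal, Pi.smul_apply, smul_eq_mul] at hi
      by_contra h0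
      exact hne i (mul_right_cancel₀ h0 hi)
    simpa [Matrix.mulVec_mulVec, Matrix.mul_nonsing_inv _ hdet] using congrArg (P *ᵥ ·) hz
  · rintro ⟨i, rfl⟩
    refine ⟨P *ᵥ Pi.single i 1, fun h => ?_, ?_⟩
    · have h0 := congrArg (P⁻¹ *ᵥ ·) h
      simp only [Matrix.mulVec_mulVec, Matrix.nonsing_inv_mul _ hdet, Matrix.one_mulVec,
        Matrix.mulVec_zero] at h0
      simpa using congrFun h0 i
    · rw [Matrix.mulVec_mulVec, Matrix.nonsing_inv_mul_cancel_right _ _ hdet,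
        ← Matrix.mulVec_mulVec, ← Matrix.mulVec_smul]
      congr 1
      funext j
      by_cases hj : j = i <;> simp [Matrix.mulVec_diagonal, hj]

theorem Matrix.charpoly_conj_diagonal {n K : Type*} [Fintype n] [DecidableEq n] [Field K]
    {P : Matrix n n K} (hP : IsUnit P) (d : n → K) :
    (P * diagonal d * P⁻¹).charpoly = ∏ i, (Polynomial.X - Polynomial.C (d i)) := by
  obtain ⟨U, rfl⟩ := hP
  rw [Matrix.charpoly_units_conj, Matrix.charpoly_diagonal]

/-- Similar diagonal matrices have the same entries, with multiplicity. -/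
theorem Matrix.map_univ_eq_of_conj_diagonal_eq {n K : Type*} [Fintype n] [DecidableEq n]
    [Field K] {P Q : Matrix n n K} (hP : IsUnit P) (hQ : IsUnit Q) {d e : n → K}
    (h : P * diagonal d * P⁻¹ = Q * diagonal e * Q⁻¹) :
    Finset.univ.val.map d = Finset.univ.val.map e := by
  have key (f : n → K) :
      (∏ i, (Polynomial.X - Polynomial.C (f i))).roots = Finset.univ.val.map f := by
    rw [Finset.prod_eq_multiset_prod,
      ← Polynomial.roots_multiset_prod_X_sub_C (Finset.univ.val.map f), Multiset.map_map]
    rfl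
  rw [← key d, ← key e, ← charpoly_conj_diagonal hP, h, charpoly_conj_diagonal hQ]

open ComplexOrder in
/-- For a Bell-diagonal two-qubit density matrix `ρ = ρ(g)` with
spin-flip `ρ̃ = (σʸ⊗σʸ) conj(ρ) (σʸ⊗σʸ)` and eigenvalues `ν₁ ≥ ν₂ ≥ ν₃ ≥ ν₄ ≥ 0` of
`ρρ̃`, the Wootters concurrence `C(ρ) = max(0, √ν₁ − √ν₂ − √ν₃ − √ν₄)` equals
`max(0, 2λ_max(ρ) − 1) = max(0, 1 − 2ε)` with `ε = 1 − λ_max(ρ)`. -/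
theorem concurrence_of_bell_diagonal (gx gy gz : ℝ)
    (hPSD : (rhoBD gx gy gz).PosSemidef)
    (ν : Fin 2 × Fin 2 → ℝ)
    (hsort : ν (1, 1) ≤ ν (1, 0) ∧ ν (1, 0) ≤ ν (0, 1) ∧ ν (0, 1) ≤ ν (0, 0))
    (hnonneg : 0 ≤ ν (1, 1))
    -- ν lists the eigenvalues of ρρ̃ : ρρ̃ is similar to the diagonal matrix of the ν's
    (P : Matrix (Fin 2 × Fin 2) (Fin 2 × Fin 2) ℂ) (hP : IsUnit P)
    (hdiag : rhoBD gx gy gz *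
        ((sigmaY ⊗ₖ sigmaY) * (rhoBD gx gy gz).map (starRingEnd ℂ) * (sigmaY ⊗ₖ sigmaY))
      = P * Matrix.diagonal (fun p => (ν p : ℂ)) * P⁻¹) :
    ∃ lam : ℝ,
      IsGreatest {c : ℝ | ∃ v : Fin 2 × Fin 2 → ℂ, v ≠ 0 ∧
        (rhoBD gx gy gz).mulVec v = (c : ℂ) • v} lam ∧
      max 0 (Real.sqrt (ν (0, 0)) - Real.sqrt (ν (0, 1))
        - Real.sqrt (ν (1, 0)) - Real.sqrt (ν (1, 1))) = max 0 (2 * lam - 1) ∧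
      max 0 (Real.sqrt (ν (0, 0)) - Real.sqrt (ν (0, 1))
        - Real.sqrt (ν (1, 0)) - Real.sqrt (ν (1, 1))) = max 0 (1 - 2 * (1 - lam)) := by
  rw [spinFlip_rhoBD, rhoBD_mul_self] at hdiag
  have hmap : Finset.univ.val.map (fun p => √(ν p)) =
      Finset.univ.val.map (bellEigenvalue gx gy gz) := by
    have h := congrArg (Multiset.map (fun z : ℂ => √z.re))
      (map_univ_eq_of_conj_diagonal_eq isUnit_bellBasis hP hdiag)
    simpa only [Multiset.map_map, Function.comp_def, Complex.ofReal_re,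
      Real.sqrt_sq (bellEigenvalue_nonneg hPSD _)] using h.symm
  have hsum : √(ν (0, 0)) + √(ν (0, 1)) + (√(ν (1, 0)) + √(ν (1, 1))) = 1 := by
    have h : ∑ p, √(ν p) = 1 := (congrArg Multiset.sum hmap).trans (sum_bellEigenvalue gx gy gz)
    simpa only [Fintype.sum_prod_type, Fin.sum_univ_two] using h
  have hmem (c : ℝ) : (∃ p, bellEigenvalue gx gy gz p = c) ↔ ∃ p, √(ν p) = c := by
    simpa using congrArg (c ∈ ·) hmap.symm
  have hspec (c : ℝ) : (∃ v : Fin 2 × Fin 2 → ℂ, v ≠ 0 ∧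
      (rhoBD gx gy gz).mulVec v = (c : ℂ) • v) ↔ ∃ p, √(ν p) = c := by
    rw [rhoBD_eq_conj_diagonal, exists_mulVec_eq_smul_conj_diagonal_iff isUnit_bellBasis,
      ← hmem]
    simp only [Complex.ofReal_inj]
  refine ⟨√(ν (0, 0)), ⟨(hspec _).2 ⟨_, rfl⟩, fun c hc => ?_⟩, ?_, ?_⟩
  · obtain ⟨p, rfl⟩ := (hspec c).1 hc
    refine Real.sqrt_le_sqrt ?_
    obtain ⟨h₁, h₂, h₃⟩ := hsort
    obtain ⟨a, b⟩ := p
    fin_cases a <;> fin_cases b <;> simp only [Fin.zero_eta, Fin.mk_one] <;> linarith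
  · congr 1
    linarith
  · congr 1
    linarith

end
end
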